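/- arXiv:2105.03738 — 2 statements merged into one kernel-verified Lean document; each statement's English description precedes it below -/
import Mathlib

section
/- Let Σ ∈ ℂ^{N×N} be Hermitian positive definite, let σ² > 0, and let Σ_FB = (Σ + J Σ* J)/2 have spectral decomposition Σ_FB = ∑_{v=1}^N λ̃_{v,FB} u_v u_v† with orthonormal eigenvectors u_v. Then the matrix M̂ = ∑_{v=1}^N max(λ̃_{v,FB}, σ²) u_v u_v† is centro-Hermitian, satisfies M̂ − σ² I positive semidefinite, and maximizes g_Σ over the set {M ∈ ℂ^{N×N} Hermitian : M = J M* J and M − σ² I positive semidefinite}. -/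
open Matrix
open scoped ComplexOrder

noncomputable section

/-- The `N × N` exchange matrix `J` (ones on the anti-diagonal, zeros elsewhere). -/
def Jex (N : ℕ) : Matrix (Fin N) (Fin N) ℂ :=
  Matrix.of fun i j => if (i : ℕ) + (j : ℕ) = N - 1 then 1 else 0

/-- `M` is centro-Hermitian: `M = J M* J`, where `M*` is the entrywise complex conjugate. -/
def CentroHermitian {N : ℕ} (M : Matrix (Fin N) (Fin N) ℂ) : Prop :=
  M = Jex N * M.map (starRingEnd ℂ) * Jex N

/-- Forward–backward average `Σ_FB = (Σ + J Σ* J)/2`. -/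
def fbAvg {N : ℕ} (S : Matrix (Fin N) (Fin N) ℂ) : Matrix (Fin N) (Fin N) ℂ :=
  (1 / 2 : ℂ) • (S + Jex N * S.map (starRingEnd ℂ) * Jex N)

/-- `g_Σ(M) = −ln det M − tr(M⁻¹ Σ)` for Hermitian positive definite matrices over ℂ
(real-valued since both terms are real in that case). -/
def gFun {N : ℕ} (S M : Matrix (Fin N) (Fin N) ℂ) : ℝ :=
  -Real.log (M.det.re) - ((M⁻¹ * S).trace).re

lemma Jex_sq (N : ℕ) : Jex N * Jex N = 1 := by
  ext i j
  rw [Matrix.mul_apply, Finset.sum_eq_single (Fin.rev i)]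
  · have hi := i.2
    have hj := j.2
    simp only [Jex, Matrix.of_apply, Fin.val_rev, Matrix.one_apply]
    rw [if_pos (by omega), one_mul]
    congr 1
    rw [Fin.ext_iff]
    apply propext
    omega
  · intro b _ hb
    have hi := i.2
    have hbb := b.2
    have : ¬ ((i : ℕ) + (b : ℕ) = N - 1) := by
      intro h
      apply hb
      rw [Fin.ext_iff, Fin.val_rev]
      omega
    simp [Jex, this]
  · simp

lemma Jex_herm (N : ℕ) : (Jex N)ᴴ = Jex N := by
  ext i j
  simp only [Jex, Matrix.conjTranspose_apply, Matrix.of_apply, add_comm (j : ℕ)]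
  split_ifs <;> simp

lemma Jex_conj (N : ℕ) : (Jex N).map (starRingEnd ℂ) = Jex N := by
  ext i j
  simp only [Jex, Matrix.map_apply, Matrix.of_apply]
  split_ifs <;> simp

lemma sum_eq_conj {N : ℕ} (u : Fin N → (Fin N → ℂ)) (d : Fin N → ℝ) :
    ∑ v, (d v : ℂ) • vecMulVec (u v) (star (u v)) =
      (Matrix.of u)ᵀ * diagonal (fun v => (d v : ℂ)) * ((Matrix.of u)ᵀ)ᴴ := by
  ext i j
  rw [Matrix.sum_apply, Matrix.mul_apply]
  refine Finset.sum_congr rfl fun v _ => ?_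
  simp [Matrix.mul_diagonal, vecMulVec_apply]
  ring

/-- functions of a normal matrix do not depend on the diagonalization -/
lemma conj_indep {N : ℕ} (U W : Matrix (Fin N) (Fin N) ℂ) (hU : Uᴴ * U = 1) (hW : Wᴴ * W = 1)
    (lam : Fin N → ℝ) (f : ℝ → ℝ)
    (h : U * diagonal (fun v => (lam v : ℂ)) * Uᴴ = W * diagonal (fun v => (lam v : ℂ)) * Wᴴ) :
    U * diagonal (fun v => (f (lam v) : ℂ)) * Uᴴ =
      W * diagonal (fun v => (f (lam v) : ℂ)) * Wᴴ := by
  have hU' : U * Uᴴ = 1 := mul_eq_one_comm.mp hU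
  have hW' : W * Wᴴ = 1 := mul_eq_one_comm.mp hW
  have h1 : diagonal (fun v => (lam v : ℂ)) * (Uᴴ * W) =
      (Uᴴ * W) * diagonal (fun v => (lam v : ℂ)) := by
    calc _ = (Uᴴ * U) * diagonal (fun v => (lam v : ℂ)) * (Uᴴ * W) := by rw [hU, one_mul]
      _ = Uᴴ * (U * diagonal (fun v => (lam v : ℂ)) * Uᴴ) * W := by simp only [Matrix.mul_assoc]
      _ = Uᴴ * (W * diagonal (fun v => (lam v : ℂ)) * Wᴴ) * W := by rw [h]
      _ = (Uᴴ * W) * diagonal (fun v => (lam v : ℂ)) * (Wᴴ * W) := by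
        simp only [Matrix.mul_assoc]
      _ = _ := by rw [hW, mul_one]
  have h2 : diagonal (fun v => (f (lam v) : ℂ)) * (Uᴴ * W) =
      (Uᴴ * W) * diagonal (fun v => (f (lam v) : ℂ)) := by
    ext i j
    have := congrFun (congrFun h1 i) j
    rw [Matrix.diagonal_mul, Matrix.mul_diagonal] at this ⊢
    by_cases hl : lam i = lam j
    · rw [hl, mul_comm]
    · have h0 : (Uᴴ * W) i j = 0 := by
        have h3 : ((lam i : ℂ) - lam j) * (Uᴴ * W) i j = 0 := by
          rw [sub_mul, this]; ring
        rcases mul_eq_zero.mp h3 with h4 | h4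
        · exact absurd (by exact_mod_cast sub_eq_zero.mp h4) hl
        · exact h4
      rw [h0]; simp
  calc _ = U * diagonal (fun v => (f (lam v) : ℂ)) * Uᴴ * (W * Wᴴ) := by rw [hW', mul_one]
    _ = U * (diagonal (fun v => (f (lam v) : ℂ)) * (Uᴴ * W)) * Wᴴ := by
      simp only [Matrix.mul_assoc]
    _ = (U * Uᴴ) * W * diagonal (fun v => (f (lam v) : ℂ)) * Wᴴ := by
      rw [h2]; simp only [Matrix.mul_assoc]
    _ = _ := by rw [hU', one_mul]

lemma map_conj_mul {N : ℕ} (A B : Matrix (Fin N) (Fin N) ℂ) :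
    (A * B).map (starRingEnd ℂ) = A.map (starRingEnd ℂ) * B.map (starRingEnd ℂ) :=
  Matrix.map_mul

lemma map_conj_conj {N : ℕ} (A : Matrix (Fin N) (Fin N) ℂ) :
    (A.map (starRingEnd ℂ)).map (starRingEnd ℂ) = A := by
  ext i j; simp

lemma phi_conj {N : ℕ} (U : Matrix (Fin N) (Fin N) ℂ) (d : Fin N → ℝ) :
    Jex N * (U * diagonal (fun v => (d v : ℂ)) * Uᴴ).map (starRingEnd ℂ) * Jex N =
      (Jex N * U.map (starRingEnd ℂ)) * diagonal (fun v => (d v : ℂ)) *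
        (Jex N * U.map (starRingEnd ℂ))ᴴ := by
  have hd : (diagonal (fun v => (d v : ℂ))).map (starRingEnd ℂ) = diagonal (fun v => (d v : ℂ)) := by
    rw [Matrix.diagonal_map (by simp)]; simp
  have hU : (Uᴴ).map (starRingEnd ℂ) = (U.map (starRingEnd ℂ))ᴴ := by
    ext i j; simp
  rw [map_conj_mul, map_conj_mul, hd, hU, Matrix.conjTranspose_mul, Jex_herm]
  simp only [Matrix.mul_assoc]

lemma fbAvg_centro {N : ℕ} (S : Matrix (Fin N) (Fin N) ℂ) : CentroHermitian (fbAvg S) := by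
  have h1 : (fbAvg S).map (starRingEnd ℂ) =
      (1 / 2 : ℂ) • (S.map (starRingEnd ℂ) + Jex N * S * Jex N) := by
    have : (Jex N * S.map (starRingEnd ℂ) * Jex N).map (starRingEnd ℂ) = Jex N * S * Jex N := by
      simp only [map_conj_mul, Jex_conj, map_conj_conj]
    rw [fbAvg, ← this]
    ext i j
    simp only [Matrix.map_apply, Matrix.smul_apply, Matrix.add_apply, smul_eq_mul, map_mul, map_add]
    simp
    exact Or.inl (Complex.conj_ofNat 2)
  unfold CentroHermitian
  rw [h1, fbAvg]
  have h2 : Jex N * (Jex N * S * Jex N) * Jex N = S := by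
    calc _ = (Jex N * Jex N) * S * (Jex N * Jex N) := by simp only [Matrix.mul_assoc]
      _ = S := by rw [Jex_sq]; simp
  rw [Matrix.mul_smul, Matrix.smul_mul, Matrix.mul_add, Matrix.add_mul, h2, add_comm]

lemma centro_part {N : ℕ} (U S : Matrix (Fin N) (Fin N) ℂ) (hU : Uᴴ * U = 1)
    (lam : Fin N → ℝ) (f : ℝ → ℝ)
    (h : fbAvg S = U * diagonal (fun v => (lam v : ℂ)) * Uᴴ) :
    CentroHermitian (U * diagonal (fun v => (f (lam v) : ℂ)) * Uᴴ) := by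
  have hc := fbAvg_centro S
  unfold CentroHermitian at hc ⊢
  rw [h] at hc
  rw [phi_conj] at hc ⊢
  refine conj_indep _ _ hU ?_ lam f hc
  rw [Matrix.conjTranspose_mul, Jex_herm]
  have hU2 : (U.map (starRingEnd ℂ))ᴴ = (Uᴴ).map (starRingEnd ℂ) := by
    ext i j; simp
  calc _ = (U.map (starRingEnd ℂ))ᴴ * (Jex N * Jex N) * U.map (starRingEnd ℂ) := by
        simp only [Matrix.mul_assoc]
    _ = 1 := by
      rw [Jex_sq, mul_one, hU2, ← map_conj_mul, hU]
      rw [Matrix.map_one _ (by simp) (by simp)]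

lemma gFun_fb {N : ℕ} (S M : Matrix (Fin N) (Fin N) ℂ) (hM : CentroHermitian M)
    (hdet : IsUnit M.det) : gFun S M = gFun (fbAvg S) M := by
  have hinv : Jex N * (M⁻¹).map (starRingEnd ℂ) * Jex N = M⁻¹ := by
    symm
    apply Matrix.inv_eq_right_inv
    have h1 : M.map (starRingEnd ℂ) * (M⁻¹).map (starRingEnd ℂ) = 1 := by
      rw [← map_conj_mul, Matrix.mul_nonsing_inv _ hdet, Matrix.map_one _ (by simp) (by simp)]
    unfold CentroHermitian at hM
    calc M * (Jex N * (M⁻¹).map (starRingEnd ℂ) * Jex N)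
        = (Jex N * M.map (starRingEnd ℂ) * Jex N) *
          (Jex N * (M⁻¹).map (starRingEnd ℂ) * Jex N) := by rw [← hM]
      _ = Jex N * M.map (starRingEnd ℂ) * (Jex N * Jex N) * (M⁻¹).map (starRingEnd ℂ) * Jex N := by
        simp only [Matrix.mul_assoc]
      _ = Jex N * (M.map (starRingEnd ℂ) * (M⁻¹).map (starRingEnd ℂ)) * Jex N := by
        rw [Jex_sq]; simp only [Matrix.mul_assoc, Matrix.one_mul]
      _ = 1 := by rw [h1, mul_one, Jex_sq]
  have htr : (M⁻¹ * (Jex N * S.map (starRingEnd ℂ) * Jex N)).trace =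
      starRingEnd ℂ ((M⁻¹ * S).trace) := by
    calc _ = ((Jex N * (M⁻¹).map (starRingEnd ℂ) * Jex N) *
          (Jex N * S.map (starRingEnd ℂ) * Jex N)).trace := by rw [hinv]
      _ = (Jex N * (M⁻¹).map (starRingEnd ℂ) * (Jex N *
          Jex N) * S.map (starRingEnd ℂ) * Jex N).trace := by simp only [Matrix.mul_assoc]
      _ = (Jex N * ((M⁻¹).map (starRingEnd ℂ) * S.map (starRingEnd ℂ)) * Jex N).trace := by
        rw [Jex_sq]; simp only [Matrix.mul_assoc, Matrix.one_mul]
      _ = ((Jex N * Jex N) * ((M⁻¹).map (starRingEnd ℂ) * S.map (starRingEnd ℂ))).trace := by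
        rw [Matrix.trace_mul_comm]; simp only [Matrix.mul_assoc]
      _ = ((M⁻¹ * S).map (starRingEnd ℂ)).trace := by
        rw [Jex_sq, one_mul, map_conj_mul]
      _ = _ := by simp only [Matrix.trace, Matrix.diag_apply, Matrix.map_apply, map_sum]
  unfold gFun
  congr 1
  rw [fbAvg, Matrix.mul_smul, Matrix.mul_add, Matrix.trace_smul, Matrix.trace_add, htr]
  simp
  ring

lemma log_det_le {N : ℕ} (A : Matrix (Fin N) (Fin N) ℂ) (hA : A.PosDef) :
    Real.log A.det.re ≤ A.trace.re - N := by
  have h1 := hA.1.det_eq_prod_eigenvalues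
  have h2 := hA.1.trace_eq_sum_eigenvalues
  have h3 : A.det.re = ∏ i, hA.1.eigenvalues i := by
    rw [h1]
    have : ∏ i, ((hA.1.eigenvalues i : ℝ) : ℂ) = ((∏ i, hA.1.eigenvalues i : ℝ) : ℂ) := by
      push_cast; rfl
    erw [this]; exact Complex.ofReal_re _
  have h4 : A.trace.re = ∑ i, hA.1.eigenvalues i := by
    rw [h2]
    have : ∑ i, ((hA.1.eigenvalues i : ℝ) : ℂ) = ((∑ i, hA.1.eigenvalues i : ℝ) : ℂ) := by
      push_cast; rfl
    erw [this]; exact Complex.ofReal_re _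
  rw [h3, h4, Real.log_prod (fun i _ => (hA.eigenvalues_pos i).ne')]
  have : (N : ℝ) = ∑ i : Fin N, (1 : ℝ) := by simp
  rw [this, ← Finset.sum_sub_distrib]
  exact Finset.sum_le_sum fun i _ => Real.log_le_sub_one_of_pos (hA.eigenvalues_pos i)

lemma posDef_of {N : ℕ} (M : Matrix (Fin N) (Fin N) ℂ) (s : ℝ) (hs : 0 < s)
    (h : (M - (s : ℂ) • (1 : Matrix (Fin N) (Fin N) ℂ)).PosSemidef) : M.PosDef := by
  have h1 : ((s : ℂ) • (1 : Matrix (Fin N) (Fin N) ℂ)).PosDef :=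
    Matrix.PosDef.one.smul (by exact_mod_cast hs)
  have := Matrix.PosDef.posSemidef_add h h1
  simpa using this

lemma diag_inv_le {N : ℕ} (M : Matrix (Fin N) (Fin N) ℂ) (s : ℝ) (hs : 0 < s)
    (h : (M - (s : ℂ) • (1 : Matrix (Fin N) (Fin N) ℂ)).PosSemidef) (v : Fin N) :
    (M⁻¹ v v).re * s ≤ 1 := by
  have hM := posDef_of M s hs h
  have hI := hM.inv
  have hdet : IsUnit M.det := (Matrix.isUnit_iff_isUnit_det _).mp hM.isUnit
  have h1 : ((M⁻¹)ᴴ * (M - (s : ℂ) • (1 : Matrix (Fin N) (Fin N) ℂ)) * M⁻¹).PosSemidef :=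
    h.conjTranspose_mul_mul_same _
  have h2 : (M⁻¹)ᴴ * (M - (s : ℂ) • (1 : Matrix (Fin N) (Fin N) ℂ)) * M⁻¹ =
      M⁻¹ - (s : ℂ) • ((M⁻¹)ᴴ * M⁻¹) := by
    rw [Matrix.mul_sub, Matrix.sub_mul, Matrix.mul_assoc, Matrix.mul_nonsing_inv _ hdet, mul_one,
      hI.1.eq]
    simp
  rw [h2] at h1
  have h3 := h1.diag_nonneg (i := v)
  have hpos := hI.diag_pos (i := v)
  rw [Complex.le_def] at h3
  rw [Complex.lt_def] at hpos
  have h4 := h3.1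
  simp only [Matrix.sub_apply, Matrix.smul_apply, Matrix.mul_apply, Complex.zero_re,
    Complex.sub_re, smul_eq_mul, Complex.re_ofReal_mul, Complex.re_sum,
    Matrix.conjTranspose_apply] at h4
  have h5 : (M⁻¹ v v).re ^ 2 ≤ ∑ x, (star (M⁻¹ x v) * M⁻¹ x v).re := by
    have h6 : ∀ x ∈ Finset.univ, 0 ≤ (star (M⁻¹ x v) * M⁻¹ x v).re := by
      intro x _
      simp
      nlinarith [sq_nonneg (M⁻¹ x v).re, sq_nonneg (M⁻¹ x v).im]
    refine le_trans ?_ (Finset.single_le_sum h6 (Finset.mem_univ v))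
    simp
    nlinarith [sq_nonneg (M⁻¹ v v).im]
  have h7 : 0 < (M⁻¹ v v).re := hpos.1
  have h8 : s * (M⁻¹ v v).re ^ 2 ≤ (M⁻¹ v v).re := by nlinarith
  by_contra hc
  push Not at hc
  nlinarith

/-- the core inequality in the diagonal basis -/
lemma core {N : ℕ} (M : Matrix (Fin N) (Fin N) ℂ) (s : ℝ) (hs : 0 < s) (lam : Fin N → ℝ)
    (h : (M - (s : ℂ) • (1 : Matrix (Fin N) (Fin N) ℂ)).PosSemidef) :
    gFun (diagonal fun v => (lam v : ℂ)) M ≤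
      gFun (diagonal fun v => (lam v : ℂ)) (diagonal fun v => ((max (lam v) s : ℝ) : ℂ)) := by
  have hM := posDef_of M s hs h
  have hmu : ∀ v, 0 < max (lam v) s := fun v => lt_max_of_lt_right hs
  set mu : Fin N → ℝ := fun v => max (lam v) s with hmudef
  have hI := hM.inv
  let D : Matrix (Fin N) (Fin N) ℂ := diagonal fun v => ((Real.sqrt (mu v) : ℝ) : ℂ)
  have hsq : ∀ v, ((Real.sqrt (mu v) : ℝ) : ℂ) * ((Real.sqrt (mu v) : ℝ) : ℂ) = (mu v : ℂ) := by
    intro v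
    rw [← Complex.ofReal_mul, Real.mul_self_sqrt (hmu v).le]
  have hDD : D * D = diagonal fun v => (mu v : ℂ) := by
    simp only [D, Matrix.diagonal_mul_diagonal, hsq]
  have hDH : Dᴴ = D := by
    simp only [D, Matrix.diagonal_conjTranspose]
    congr 1
    ext v
    simp
  have hDu : IsUnit D := by
    rw [Matrix.isUnit_iff_isUnit_det, Matrix.det_diagonal, isUnit_iff_ne_zero]
    refine Finset.prod_ne_zero_iff.mpr fun v _ => ?_
    exact_mod_cast (Real.sqrt_pos.mpr (hmu v)).ne'
  have hA : (Dᴴ * M⁻¹ * D).PosDef :=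
    hI.conjTranspose_mul_mul_same (Matrix.mulVec_injective_of_isUnit hDu)
  have hlog := log_det_le _ hA
  rw [hDH] at hlog
  have hdetmu : (diagonal fun v => (mu v : ℂ)).det = ((∏ v, mu v : ℝ) : ℂ) := by
    rw [Matrix.det_diagonal]; push_cast; rfl
  have hPpos : 0 < ∏ v, mu v := Finset.prod_pos fun v _ => hmu v
  have hdM : 0 < M.det.re := (Complex.lt_def.mp hM.det_pos).1
  have hdMi : M.det = (M.det.re : ℂ) := by
    apply Complex.ext
    · simp
    · simpa using (Complex.lt_def.mp hM.det_pos).2.symm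
  have hdetA : (D * M⁻¹ * D).det.re = (∏ v, mu v) * (M.det.re)⁻¹ := by
    have : (D * M⁻¹ * D).det = (D * D).det * (M.det)⁻¹ := by
      rw [Matrix.det_mul, Matrix.det_mul, Matrix.det_mul, Matrix.det_nonsing_inv,
        Ring.inverse_eq_inv']
      ring
    rw [this, hDD, hdetmu, hdMi, ← Complex.ofReal_inv, ← Complex.ofReal_mul, Complex.ofReal_re, Complex.ofReal_re]
  have htrA : (D * M⁻¹ * D).trace.re = ∑ v, (M⁻¹ v v).re * mu v := by
    rw [Matrix.mul_assoc, Matrix.trace_mul_comm, Matrix.mul_assoc, hDD]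
    simp [Matrix.trace, Matrix.mul_diagonal]
  rw [hdetA, htrA, Real.log_mul hPpos.ne' (inv_ne_zero hdM.ne'), Real.log_inv] at hlog
  have htr1 : (M⁻¹ * diagonal fun v => (lam v : ℂ)).trace.re = ∑ v, (M⁻¹ v v).re * lam v := by
    simp [Matrix.trace, Matrix.mul_diagonal]
  have hinv : (diagonal fun v => (mu v : ℂ))⁻¹ = diagonal fun v => (((mu v)⁻¹ : ℝ) : ℂ) := by
    apply Matrix.inv_eq_right_inv
    rw [Matrix.diagonal_mul_diagonal, ← Matrix.diagonal_one]
    congr 1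
    ext v
    rw [← Complex.ofReal_mul, mul_inv_cancel₀ (hmu v).ne']
    simp
  have htr2 : ((diagonal fun v => (mu v : ℂ))⁻¹ * diagonal fun v => (lam v : ℂ)).trace.re =
      ∑ v, (mu v)⁻¹ * lam v := by
    rw [hinv, Matrix.diagonal_mul_diagonal, Matrix.trace_diagonal]
    simp only [← Complex.ofReal_mul, Complex.re_sum, Complex.ofReal_re]
  unfold gFun
  rw [htr1, htr2, hdetmu, Complex.ofReal_re]
  have hkey : ∑ v, ((M⁻¹ v v).re * mu v - 1) ≤
      ∑ v, ((M⁻¹ v v).re * lam v - (mu v)⁻¹ * lam v) := by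
    refine Finset.sum_le_sum fun v _ => ?_
    have hd := diag_inv_le M s hs h v
    rcases le_total s (lam v) with hl | hl
    · have : mu v = lam v := max_eq_left hl
      rw [this, inv_mul_cancel₀ (by linarith)]
    · have : mu v = s := max_eq_right hl
      rw [this]
      have h1 : s⁻¹ * lam v ≤ 1 := by
        rw [inv_mul_le_iff₀ hs]; linarith
      have h2 : (M⁻¹ v v).re * lam v = ((M⁻¹ v v).re * s) * (s⁻¹ * lam v) := by
        field_simp
      rw [h2]
      nlinarith
  rw [Finset.sum_sub_distrib, Finset.sum_sub_distrib] at hkey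
  simp at hkey
  linarith

lemma gFun_conj {N : ℕ} (U T M : Matrix (Fin N) (Fin N) ℂ) (hU : Uᴴ * U = 1) :
    gFun (U * T * Uᴴ) M = gFun T (Uᴴ * M * U) := by
  have hU' : U * Uᴴ = 1 := mul_eq_one_comm.mp hU
  have hi : U⁻¹ = Uᴴ := Matrix.inv_eq_right_inv hU'
  have hi' : (Uᴴ)⁻¹ = U := Matrix.inv_eq_right_inv hU
  unfold gFun
  rw [Matrix.mul_inv_rev, Matrix.mul_inv_rev, hi, hi']
  congr 2
  · rw [Matrix.mul_assoc, Matrix.det_mul_comm, Matrix.mul_assoc, hU', mul_one]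
  · rw [← Matrix.mul_assoc, Matrix.trace_mul_comm]
    simp only [Matrix.mul_assoc]

/-- let `Σ` be Hermitian positive definite, `σ² > 0`, and let
`Σ_FB = ∑_v λ̃_{v,FB} u_v u_v†` be a spectral decomposition of the forward–backward average.
Then `M̂ = ∑_v max(λ̃_{v,FB}, σ²) u_v u_v†` is centro-Hermitian, satisfies `M̂ − σ² I ⪰ 0`,
and maximizes `g_Σ` over `{M Hermitian : M = J M* J and M − σ² I ⪰ 0}`. -/
theorem stmt9 {N : ℕ} (σsq : ℝ) (hσ : 0 < σsq)
    (S : Matrix (Fin N) (Fin N) ℂ) (hS : S.PosDef)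
    (lam : Fin N → ℝ) (u : Fin N → (Fin N → ℂ))
    (hortho : ∀ v w, star (u v) ⬝ᵥ u w = if v = w then 1 else 0)
    (hdecomp : fbAvg S = ∑ v, (lam v : ℂ) • vecMulVec (u v) (star (u v))) :
    CentroHermitian (∑ v, ((max (lam v) σsq : ℝ) : ℂ) • vecMulVec (u v) (star (u v)))
    ∧ (((∑ v, ((max (lam v) σsq : ℝ) : ℂ) • vecMulVec (u v) (star (u v)))
          - (σsq : ℂ) • (1 : Matrix (Fin N) (Fin N) ℂ)).PosSemidef)
    ∧ ∀ M : Matrix (Fin N) (Fin N) ℂ, M.IsHermitian → CentroHermitian M →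
        (M - (σsq : ℂ) • (1 : Matrix (Fin N) (Fin N) ℂ)).PosSemidef →
        gFun S M ≤ gFun S (∑ v, ((max (lam v) σsq : ℝ) : ℂ) • vecMulVec (u v) (star (u v))) := by
  set U : Matrix (Fin N) (Fin N) ℂ := (Matrix.of u)ᵀ with hUdef
  have hU : Uᴴ * U = 1 := by
    ext v w
    have := hortho v w
    simpa [Matrix.mul_apply, hUdef, dotProduct, Matrix.one_apply] using this
  have hU' : U * Uᴴ = 1 := mul_eq_one_comm.mp hU
  rw [sum_eq_conj] at hdecomp
  have hMh := sum_eq_conj u (fun v => max (lam v) σsq)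
  rw [hMh]
  have hc : CentroHermitian (U * diagonal (fun v => ((max (lam v) σsq : ℝ) : ℂ)) * Uᴴ) :=
    centro_part U S hU lam (fun x => max x σsq) hdecomp
  have hp : (U * diagonal (fun v => ((max (lam v) σsq : ℝ) : ℂ)) * Uᴴ
      - (σsq : ℂ) • (1 : Matrix (Fin N) (Fin N) ℂ)).PosSemidef := by
    have h1 : U * diagonal (fun v => ((max (lam v) σsq : ℝ) : ℂ)) * Uᴴ
      - (σsq : ℂ) • (1 : Matrix (Fin N) (Fin N) ℂ) =
      U * diagonal (fun v => ((max (lam v) σsq - σsq : ℝ) : ℂ)) * Uᴴ := by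
      have h2 : diagonal (fun v => ((max (lam v) σsq - σsq : ℝ) : ℂ)) =
          diagonal (fun v => ((max (lam v) σsq : ℝ) : ℂ)) -
            (σsq : ℂ) • (1 : Matrix (Fin N) (Fin N) ℂ) := by
        rw [Matrix.smul_one_eq_diagonal, Matrix.diagonal_sub]
        simp only [Complex.ofReal_sub]
      rw [h2, Matrix.mul_sub, Matrix.sub_mul, Matrix.mul_smul, Matrix.smul_mul, mul_one, hU']
    rw [h1]
    refine Matrix.PosSemidef.mul_mul_conjTranspose_same ?_ U
    rw [Matrix.posSemidef_diagonal_iff]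
    intro v
    have : 0 ≤ max (lam v) σsq - σsq := sub_nonneg.mpr (le_max_right _ _)
    exact_mod_cast this
  refine ⟨hc, hp, ?_⟩
  intro M _ hMc hMp
  have hdet : ∀ A : Matrix (Fin N) (Fin N) ℂ,
      (A - (σsq : ℂ) • (1 : Matrix (Fin N) (Fin N) ℂ)).PosSemidef → IsUnit A.det := fun A hA =>
    (Matrix.isUnit_iff_isUnit_det _).mp (posDef_of A σsq hσ hA).isUnit
  rw [gFun_fb S M hMc (hdet M hMp), gFun_fb S _ hc (hdet _ hp), hdecomp,
    gFun_conj U _ _ hU, gFun_conj U _ _ hU]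
  have h3 : Uᴴ * (U * diagonal (fun v => ((max (lam v) σsq : ℝ) : ℂ)) * Uᴴ) * U =
      diagonal (fun v => ((max (lam v) σsq : ℝ) : ℂ)) := by
    calc _ = (Uᴴ * U) * diagonal (fun v => ((max (lam v) σsq : ℝ) : ℂ)) * (Uᴴ * U) := by
          simp only [Matrix.mul_assoc]
      _ = _ := by rw [hU, one_mul, mul_one]
  rw [h3]
  refine core _ σsq hσ lam ?_
  have h4 := hMp.conjTranspose_mul_mul_same U
  rw [Matrix.mul_sub, Matrix.sub_mul, Matrix.mul_smul, Matrix.smul_mul, mul_one, hU] at h4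
  exact h4
end
end

section
/- In the missing-data model, let δ > 0 and let C be a set of Hermitian positive definite N×N matrices such that λ_min(M) ≥ δ for every M ∈ C. Let (M_h)_{h≥1} be a sequence in C such that, for every h ≥ 2, M_h maximizes the map M ↦ −ln det M − tr(M^{−1} Σ(M_{h−1})) over C, where Σ(M′) = (1/K) ∑_{i=1}^K C(M′, A_i, y_i). Then the sequence of observed-data log-likelihood values L_y(M_h) is nondecreasing in h and converges to a finite limit. -/
open Matrix
open scoped ComplexOrder

noncomputable section

/-- `A` is a selection matrix and `B` is its complementary selection matrix, whose rows are
the remaining `N - p` rows of the identity matrix. -/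
def IsComplementarySelectionPair {p N : ℕ} (A : Matrix (Fin p) (Fin N) ℂ)
    (B : Matrix (Fin (N - p)) (Fin N) ℂ) : Prop :=
  ∃ (f : Fin p → Fin N) (g : Fin (N - p) → Fin N),
    Function.Injective f ∧ Function.Injective g ∧
    Set.range g = (Set.range f)ᶜ ∧
    (∀ i j, A i j = if j = f i then 1 else 0) ∧
    (∀ i j, B i j = if j = g i then 1 else 0)

/-- `μ(M, A, y) = Ā M A† (A M A†)⁻¹ y`. -/
def muVec {p N : ℕ} (M : Matrix (Fin N) (Fin N) ℂ) (A : Matrix (Fin p) (Fin N) ℂ)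
    (B : Matrix (Fin (N - p)) (Fin N) ℂ) (y : Fin p → ℂ) : Fin (N - p) → ℂ :=
  (B * M * Aᴴ * (A * M * Aᴴ)⁻¹) *ᵥ y

/-- `G(M, A) = Ā M Ā† − Ā M A† (A M A†)⁻¹ A M Ā†`. -/
def Gmat {p N : ℕ} (M : Matrix (Fin N) (Fin N) ℂ) (A : Matrix (Fin p) (Fin N) ℂ)
    (B : Matrix (Fin (N - p)) (Fin N) ℂ) : Matrix (Fin (N - p)) (Fin (N - p)) ℂ :=
  B * M * Bᴴ - B * M * Aᴴ * (A * M * Aᴴ)⁻¹ * (A * M * Bᴴ)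

/-- Conditional correlation matrix
`C(M, A, y) = (A† y + Ā† μ)(A† y + Ā† μ)† + Ā† G(M, A) Ā`. -/
def Cmat {p N : ℕ} (M : Matrix (Fin N) (Fin N) ℂ) (A : Matrix (Fin p) (Fin N) ℂ)
    (B : Matrix (Fin (N - p)) (Fin N) ℂ) (y : Fin p → ℂ) : Matrix (Fin N) (Fin N) ℂ :=
  vecMulVec (Aᴴ *ᵥ y + Bᴴ *ᵥ muVec M A B y) (star (Aᴴ *ᵥ y + Bᴴ *ᵥ muVec M A B y))
    + Bᴴ * Gmat M A B * B

/-- EM conditional sample covariance `Σ(M′) = (1/K) ∑_{i=1}^K C(M′, A_i, y_i)`. -/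
def SigmaEM {N K : ℕ} (p : Fin K → ℕ) (A : ∀ i, Matrix (Fin (p i)) (Fin N) ℂ)
    (B : ∀ i, Matrix (Fin (N - p i)) (Fin N) ℂ) (y : ∀ i, Fin (p i) → ℂ)
    (M : Matrix (Fin N) (Fin N) ℂ) : Matrix (Fin N) (Fin N) ℂ :=
  ((K : ℂ)⁻¹) • ∑ i, Cmat M (A i) (B i) (y i)

/-- Observed-data log-likelihood
`L_y(M) = −∑_{i=1}^K [ p_i ln π + ln det(A_i M A_i†) + y_i† (A_i M A_i†)⁻¹ y_i ]`. -/
def obsLogLik {N K : ℕ} (p : Fin K → ℕ) (A : ∀ i, Matrix (Fin (p i)) (Fin N) ℂ)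
    (y : ∀ i, Fin (p i) → ℂ) (M : Matrix (Fin N) (Fin N) ℂ) : ℝ :=
  -∑ i, ((p i : ℝ) * Real.log Real.pi
      + Real.log ((A i * M * (A i)ᴴ).det.re)
      + (star (y i) ⬝ᵥ ((A i * M * (A i)ᴴ)⁻¹ *ᵥ y i)).re)


lemma aux_trace_logdet {n : ℕ} {X : Matrix (Fin n) (Fin n) ℂ} (hX : X.PosDef) :
    Real.log X.det.re + n ≤ X.trace.re := by
  have h1 : X.det.re = ∏ i, hX.isHermitian.eigenvalues i := by
    rw [hX.isHermitian.det_eq_prod_eigenvalues]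
    norm_cast
  have h2 : X.trace.re = ∑ i, hX.isHermitian.eigenvalues i := by
    rw [hX.isHermitian.trace_eq_sum_eigenvalues]
    norm_cast
  rw [h1, h2, Real.log_prod (fun i _ => (hX.eigenvalues_pos i).ne')]
  have : (n : ℝ) = ∑ i : Fin n, (1 : ℝ) := by simp
  rw [this, ← Finset.sum_add_distrib]
  refine Finset.sum_le_sum fun i _ => ?_
  have := Real.log_le_sub_one_of_pos (hX.eigenvalues_pos i)
  linarith

lemma aux_det {n : ℕ} {X : Matrix (Fin n) (Fin n) ℂ} (hX : X.PosDef) :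
    0 < X.det.re ∧ X.det.im = 0 := by
  have := hX.det_pos
  rw [Complex.lt_def] at this
  exact ⟨by simpa using this.1, by simpa using this.2.symm⟩

open scoped MatrixOrder in
lemma aux_pair {n : ℕ} {P Q : Matrix (Fin n) (Fin n) ℂ} (hP : P.PosDef) (hQ : Q.PosDef) :
    Real.log Q.det.re + n ≤ Real.log P.det.re + (P⁻¹ * Q).trace.re := by
  obtain ⟨R, hRu, hR⟩ : ∃ R : Matrix (Fin n) (Fin n) ℂ, IsUnit R ∧ P⁻¹ = Rᴴ * R := by
    obtain ⟨R, hR, h⟩ := (Matrix.isStrictlyPositive_iff_posDef.mpr hP.inv) |> CStarAlgebra.isStrictlyPositive_iff_eq_star_mul_self.mp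
    exact ⟨R, hR, h⟩
  have hX : (R * Q * Rᴴ).PosDef := by
    refine hQ.mul_mul_conjTranspose_same ?_
    exact Matrix.vecMul_injective_of_isUnit hRu
  have h := aux_trace_logdet hX
  have ht : (R * Q * Rᴴ).trace = (P⁻¹ * Q).trace := by
    rw [Matrix.trace_mul_comm, hR, Matrix.mul_assoc]
  have hd : (R * Q * Rᴴ).det * P.det = Q.det := by
    have h1 : (Rᴴ * R).det * P.det = 1 := by
      rw [← hR, ← det_mul, Matrix.nonsing_inv_mul _ (Matrix.isUnit_iff_isUnit_det _ |>.mp hP.isUnit), det_one]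
    rw [det_mul] at h1
    rw [det_mul, det_mul]
    linear_combination Q.det * h1
  have hd2 : (R * Q * Rᴴ).det.re * P.det.re = Q.det.re := by
    rw [← hd, Complex.mul_re, (aux_det hP).2]; simp
  rw [← hd2, Real.log_mul (aux_det hX).1.ne' (aux_det hP).1.ne', ← ht]
  linarith

lemma aux_logdet_lb {n : ℕ} {P : Matrix (Fin n) (Fin n) ℂ} (hP : P.PosDef) {δ : ℝ} (hδ : 0 < δ)
    (h : (P - (δ : ℂ) • (1 : Matrix (Fin n) (Fin n) ℂ)).PosSemidef) :
    n * Real.log δ ≤ Real.log P.det.re := by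
  have h1 : P.det.re = ∏ i, hP.isHermitian.eigenvalues i := by
    rw [hP.isHermitian.det_eq_prod_eigenvalues]
    norm_cast
  rw [h1, Real.log_prod (fun i _ => (hP.eigenvalues_pos i).ne')]
  have : (n : ℝ) * Real.log δ = ∑ i : Fin n, Real.log δ := by simp
  rw [this]
  refine Finset.sum_le_sum fun i _ => Real.log_le_log hδ ?_
  set v := hP.isHermitian.eigenvectorBasis i with hv
  have h2 := h.dotProduct_mulVec_nonneg (v.ofLp)
  have h3 : v.ofLp ≠ 0 := by
    intro h0
    have : v = 0 := by ext j; exact congrFun h0 j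
    have h4 := hP.isHermitian.eigenvectorBasis.orthonormal.ne_zero i
    exact h4 this
  have h5 : 0 < star v.ofLp ⬝ᵥ v.ofLp := Matrix.dotProduct_star_self_pos_iff.mpr h3
  rw [Matrix.sub_mulVec, hP.isHermitian.mulVec_eigenvectorBasis, Matrix.smul_mulVec, one_mulVec,
    dotProduct_sub, dotProduct_smul, dotProduct_smul] at h2
  rw [Complex.lt_def] at h5
  rw [Complex.le_def] at h2
  have h6 := h2.1
  have h7 := h5.1
  simp at h6 h7
  by_contra hc
  push Not at hc
  nlinarith

structure SelPair {p q N : ℕ} (A : Matrix (Fin p) (Fin N) ℂ) (B : Matrix (Fin q) (Fin N) ℂ) :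
    Prop where
  aa : A * Aᴴ = 1
  bb : B * Bᴴ = 1
  ab : A * Bᴴ = 0
  ba : B * Aᴴ = 0
  sum : Aᴴ * A + Bᴴ * B = 1

lemma selPair {p N : ℕ} {A : Matrix (Fin p) (Fin N) ℂ}
    {B : Matrix (Fin (N - p)) (Fin N) ℂ} (h : IsComplementarySelectionPair A B) :
    SelPair A B := by
  obtain ⟨f, g, hf, hg, hr, hA, hB⟩ := h
  have hfg : ∀ i j, f i ≠ g j := by
    intro i j hij
    have : g j ∈ (Set.range f)ᶜ := hr ▸ Set.mem_range_self j
    exact this ⟨i, hij⟩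
  have hab : A * Bᴴ = 0 := by
    ext i j
    simpa [Matrix.mul_apply, hA, hB, apply_ite] using (hfg i j).symm
  refine ⟨?_, ?_, hab, ?_, ?_⟩
  · ext i j
    simp [Matrix.mul_apply, hA, Matrix.one_apply, hf.eq_iff, eq_comm (a := i)]
  · ext i j
    simp [Matrix.mul_apply, hB, Matrix.one_apply, hg.eq_iff, eq_comm (a := i)]
  · have := congrArg conjTranspose hab
    simpa using this
  · ext i j
    simp only [Matrix.add_apply, Matrix.mul_apply, conjTranspose_apply, hA, hB, Matrix.one_apply]
    by_cases hi : i ∈ Set.range f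
    · obtain ⟨k, rfl⟩ := hi
      have h0 : ∀ x, (star (if f k = f x then (1 : ℂ) else 0)) = if k = x then 1 else 0 := by
        intro x; simp [hf.eq_iff, apply_ite]
      simp only [h0, ite_mul, one_mul, zero_mul, Finset.sum_ite_eq, Finset.mem_univ, if_true]
      simp [hfg, eq_comm (a := j)]
    · have hi2 : i ∈ Set.range g := by rw [hr]; exact hi
      obtain ⟨k, rfl⟩ := hi2
      have : ∀ i j, g i ≠ f j := fun i j => (hfg j i).symm
      have h0 : ∀ x, (star (if g k = g x then (1 : ℂ) else 0)) = if k = x then 1 else 0 := by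
        intro x; simp [hg.eq_iff, apply_ite]
      simp only [h0, ite_mul, one_mul, zero_mul, Finset.sum_ite_eq, Finset.mem_univ, if_true]
      simp [this, eq_comm (a := j)]

lemma SelPair.posDef {p q N : ℕ} {A : Matrix (Fin p) (Fin N) ℂ} {B : Matrix (Fin q) (Fin N) ℂ}
    (h : SelPair A B) {M : Matrix (Fin N) (Fin N) ℂ} (hM : M.PosDef) : (A * M * Aᴴ).PosDef := by
  refine hM.mul_mul_conjTranspose_same ?_
  intro u v huv
  have := congrArg (fun w => w ᵥ* Aᴴ) huv
  simpa [vecMul_vecMul, h.aa] using this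

section
variable {p N : ℕ} {A : Matrix (Fin p) (Fin N) ℂ} {B : Matrix (Fin (N - p)) (Fin N) ℂ}
  {M : Matrix (Fin N) (Fin N) ℂ}

def Smat (M : Matrix (Fin N) (Fin N) ℂ) (A : Matrix (Fin p) (Fin N) ℂ)
    (B : Matrix (Fin (N - p)) (Fin N) ℂ) := B * M * Aᴴ * (A * M * Aᴴ)⁻¹

def Wmat (M : Matrix (Fin N) (Fin N) ℂ) (A : Matrix (Fin p) (Fin N) ℂ)
    (B : Matrix (Fin (N - p)) (Fin N) ℂ) := B - Smat M A B * A

lemma W_M_A (h : SelPair A B) (hM : M.PosDef) : Wmat M A B * M * Aᴴ = 0 := by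
  have hu := Matrix.isUnit_iff_isUnit_det _ |>.mp (h.posDef hM).isUnit
  have : Wmat M A B * M * Aᴴ = B * M * Aᴴ - B * M * Aᴴ * ((A * M * Aᴴ)⁻¹ * (A * M * Aᴴ)) := by
    simp only [Wmat, Smat, Matrix.sub_mul, Matrix.mul_assoc]
  rw [this, Matrix.nonsing_inv_mul _ hu, Matrix.mul_one, sub_self]

lemma A_M_W (h : SelPair A B) (hM : M.PosDef) : A * M * (Wmat M A B)ᴴ = 0 := by
  have := congrArg conjTranspose (W_M_A h hM)
  simpa [hM.isHermitian.eq, Matrix.mul_assoc] using this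

lemma W_M_B : Wmat M A B * M * Bᴴ = Gmat M A B := by
  simp only [Wmat, Smat, Gmat, Matrix.sub_mul, Matrix.mul_assoc]

lemma W_M_W (h : SelPair A B) (hM : M.PosDef) : Wmat M A B * M * (Wmat M A B)ᴴ = Gmat M A B := by
  have : (Wmat M A B)ᴴ = Bᴴ - Aᴴ * (Smat M A B)ᴴ := by simp [Wmat]
  rw [this, Matrix.mul_sub, ← Matrix.mul_assoc, W_M_A h hM, W_M_B]
  simp

lemma W_B (h : SelPair A B) : Wmat M A B * Bᴴ = 1 := by
  simp [Wmat, Matrix.sub_mul, Matrix.mul_assoc, h.ab, h.bb]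

lemma G_posDef (h : SelPair A B) (hM : M.PosDef) : (Gmat M A B).PosDef := by
  rw [← W_M_W h hM]
  refine hM.mul_mul_conjTranspose_same ?_
  intro u v huv
  have := congrArg (fun w => w ᵥ* Bᴴ) huv
  simpa [vecMul_vecMul, W_B h] using this

lemma inv_eq' (h : SelPair A B) (hM : M.PosDef) :
    M⁻¹ = Aᴴ * (A * M * Aᴴ)⁻¹ * A + (Wmat M A B)ᴴ * (Gmat M A B)⁻¹ * Wmat M A B := by
  set X := Aᴴ * (A * M * Aᴴ)⁻¹ * A + (Wmat M A B)ᴴ * (Gmat M A B)⁻¹ * Wmat M A B with hX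
  have hu := Matrix.isUnit_iff_isUnit_det _ |>.mp (h.posDef hM).isUnit
  have hv := Matrix.isUnit_iff_isUnit_det _ |>.mp (G_posDef h hM).isUnit
  have h1 : X * M * Aᴴ = Aᴴ := by
    have : X * M * Aᴴ = Aᴴ * ((A * M * Aᴴ)⁻¹ * (A * M * Aᴴ))
        + (Wmat M A B)ᴴ * (Gmat M A B)⁻¹ * (Wmat M A B * M * Aᴴ) := by
      simp only [hX, Matrix.add_mul, Matrix.mul_assoc]
    rw [this, W_M_A h hM, Matrix.nonsing_inv_mul _ hu]; simp
  have h2 : X * M * (Wmat M A B)ᴴ = (Wmat M A B)ᴴ := by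
    have : X * M * (Wmat M A B)ᴴ = Aᴴ * (A * M * Aᴴ)⁻¹ * (A * M * (Wmat M A B)ᴴ)
        + (Wmat M A B)ᴴ * ((Gmat M A B)⁻¹ * (Wmat M A B * M * (Wmat M A B)ᴴ)) := by
      simp only [hX, Matrix.add_mul, Matrix.mul_assoc]
    rw [this, A_M_W h hM, W_M_W h hM, Matrix.nonsing_inv_mul _ hv]; simp
  have h3 : Bᴴ = (Wmat M A B)ᴴ + Aᴴ * (Smat M A B)ᴴ := by simp [Wmat]
  have h4 : X * M * Bᴴ = Bᴴ := by
    rw [h3, Matrix.mul_add, h2, ← Matrix.mul_assoc, h1]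
  apply Matrix.inv_eq_left_inv
  calc X * M = X * M * (Aᴴ * A + Bᴴ * B) := by rw [h.sum, Matrix.mul_one]
    _ = 1 := by rw [Matrix.mul_add, ← Matrix.mul_assoc, ← Matrix.mul_assoc, h1, h4, h.sum]

lemma det_eq' (h : SelPair A B) (hM : M.PosDef) :
    M.det = (A * M * Aᴴ).det * (Gmat M A B).det := by
  have hTT : (fromRows A B)ᴴ * fromRows A B = 1 := by
    rw [conjTranspose_fromRows_eq_fromCols_conjTranspose, fromCols_mul_fromRows, h.sum]
  have hTT' : fromRows A B * (fromRows A B)ᴴ = 1 := by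
    rw [conjTranspose_fromRows_eq_fromCols_conjTranspose, fromRows_mul_fromCols, h.aa, h.ab, h.ba,
      h.bb, fromBlocks_one]
  have h1 : (fromRows A B * M * (fromRows A B)ᴴ).det = M.det :=
    Matrix.det_conj_of_mul_eq_one hTT' hTT 
  have h2 : fromRows A B * M * (fromRows A B)ᴴ =
      fromBlocks (A * M * Aᴴ) (A * M * Bᴴ) (B * M * Aᴴ) (B * M * Bᴴ) := by
    rw [conjTranspose_fromRows_eq_fromCols_conjTranspose, fromRows_mul, fromRows_mul_fromCols]
  haveI : Invertible (A * M * Aᴴ) := (h.posDef hM).isUnit.invertible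
  rw [← h1, h2, det_fromBlocks₁₁, invOf_eq_nonsing_inv, Gmat]

lemma logdet_eq (h : SelPair A B) (hM : M.PosDef) :
    Real.log M.det.re = Real.log (A * M * Aᴴ).det.re + Real.log (Gmat M A B).det.re := by
  have h1 := aux_det (h.posDef hM)
  have h2 := aux_det (G_posDef h hM)
  rw [det_eq' h hM, Complex.mul_re, h1.2, ← Real.log_mul h1.1.ne' h2.1.ne']; simp

lemma quad_W {p N : ℕ} (V : Matrix (Fin p) (Fin N) ℂ) (Q : Matrix (Fin p) (Fin p) ℂ)
    (z : Fin N → ℂ) : (Vᴴ * Q * V * vecMulVec z (star z)).trace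
      = star (V *ᵥ z) ⬝ᵥ (Q *ᵥ (V *ᵥ z)) := by
  rw [Matrix.mul_vecMulVec, trace_vecMulVec, star_mulVec, dotProduct_comm, ← mulVec_mulVec,
    ← mulVec_mulVec, dotProduct_mulVec]

lemma trace_eq' (h : SelPair A B) (hM : M.PosDef) (M' : Matrix (Fin N) (Fin N) ℂ)
    (y : Fin p → ℂ) :
    (M⁻¹ * Cmat M' A B y).trace = star y ⬝ᵥ ((A * M * Aᴴ)⁻¹ *ᵥ y)
      + star (muVec M' A B y - muVec M A B y) ⬝ᵥ
          ((Gmat M A B)⁻¹ *ᵥ (muVec M' A B y - muVec M A B y))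
      + ((Gmat M A B)⁻¹ * Gmat M' A B).trace := by
  set z := Aᴴ *ᵥ y + Bᴴ *ᵥ muVec M' A B y with hz
  have hAz : A *ᵥ z = y := by simp [hz, mulVec_add, h.aa, h.ab]
  have hBz : B *ᵥ z = muVec M' A B y := by simp [hz, mulVec_add, h.ba, h.bb]
  have hWz : Wmat M A B *ᵥ z = muVec M' A B y - muVec M A B y := by
    rw [Wmat, sub_mulVec, hBz, ← mulVec_mulVec, hAz]; rfl
  have hWB : B * (Wmat M A B)ᴴ = 1 := by
    have := congrArg conjTranspose (W_B (M := M) h)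
    simpa using this
  have hB : B * M⁻¹ * Bᴴ = (Gmat M A B)⁻¹ := by
    have : B * M⁻¹ * Bᴴ = (B * Aᴴ) * (A * M * Aᴴ)⁻¹ * (A * Bᴴ)
       + (B * (Wmat M A B)ᴴ) * (Gmat M A B)⁻¹ * (Wmat M A B * Bᴴ) := by
      rw [inv_eq' h hM]
      simp only [Matrix.add_mul, Matrix.mul_add, Matrix.mul_assoc]
    rw [this, hWB, W_B h, h.ab]; simp
  have h2 : (M⁻¹ * (Bᴴ * Gmat M' A B * B)).trace = ((Gmat M A B)⁻¹ * Gmat M' A B).trace := by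
    rw [← hB, ← Matrix.mul_assoc, Matrix.trace_mul_comm]
    simp only [Matrix.mul_assoc]
  rw [Cmat, ← hz, Matrix.mul_add, trace_add, h2, inv_eq' h hM, Matrix.add_mul, trace_add,
    quad_W, quad_W, hAz, hWz]

lemma key (h : SelPair A B) {M' : Matrix (Fin N) (Fin N) ℂ} (hM : M.PosDef) (hM' : M'.PosDef)
    (y : Fin p → ℂ) :
    (Real.log M'.det.re + (M'⁻¹ * Cmat M' A B y).trace.re)
      - (Real.log (A * M' * Aᴴ).det.re + (star y ⬝ᵥ ((A * M' * Aᴴ)⁻¹ *ᵥ y)).re)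
    ≤ (Real.log M.det.re + (M⁻¹ * Cmat M' A B y).trace.re)
      - (Real.log (A * M * Aᴴ).det.re + (star y ⬝ᵥ ((A * M * Aᴴ)⁻¹ *ᵥ y)).re) := by
  have hG := G_posDef h hM
  have hG' := G_posDef h hM'
  have hv := Matrix.isUnit_iff_isUnit_det _ |>.mp hG'.isUnit
  rw [trace_eq' h hM, trace_eq' h hM', logdet_eq h hM, logdet_eq h hM', Matrix.nonsing_inv_mul _ hv]
  have h1 := aux_pair hG hG'
  have h2 := (hG.inv).posSemidef.dotProduct_mulVec_nonneg (muVec M' A B y - muVec M A B y)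
  have h3 := (Complex.le_def.mp h2).1
  simp only [Complex.add_re, sub_self, mulVec_zero, dotProduct_zero, Complex.zero_re, trace_one,
    Fintype.card_fin, Complex.natCast_re] at h3 ⊢
  linarith

end

lemma trace_Sigma {N K : ℕ} (hK : 0 < K)
    (p : Fin K → ℕ)
    (A : ∀ i, Matrix (Fin (p i)) (Fin N) ℂ)
    (B : ∀ i, Matrix (Fin (N - p i)) (Fin N) ℂ)
    (y : ∀ i, Fin (p i) → ℂ) (M M' : Matrix (Fin N) (Fin N) ℂ) :
    ∑ i, (Real.log M.det.re + (M⁻¹ * Cmat M' (A i) (B i) (y i)).trace.re)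
      = K * (Real.log M.det.re + (M⁻¹ * SigmaEM p A B y M').trace.re) := by
  have hK' : (K : ℝ) ≠ 0 := by positivity
  have h : (M⁻¹ * SigmaEM p A B y M').trace.re
      = (K : ℝ)⁻¹ * ∑ i, (M⁻¹ * Cmat M' (A i) (B i) (y i)).trace.re := by
    have h0 : (K : ℂ)⁻¹ = (((K : ℝ)⁻¹ : ℝ) : ℂ) := by push_cast; rfl
    rw [SigmaEM, Matrix.mul_smul, trace_smul, Matrix.mul_sum, trace_sum, smul_eq_mul, h0,
      Complex.re_ofReal_mul, Complex.re_sum]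
  rw [h, Finset.sum_add_distrib, mul_add, mul_inv_cancel_left₀ hK']
  simp

/-- in the missing-data model, let `C` be a set of Hermitian positive definite
matrices with `λ_min(M) ≥ δ > 0` for every `M ∈ C` (equivalently, `M − δ I ⪰ 0`).  If
`(M_h)` is a sequence in `C` such that each `M_{h+1}` maximizes the EM surrogate
`M ↦ −ln det M − tr(M⁻¹ Σ(M_h))` over `C`, then `h ↦ L_y(M_h)` is nondecreasing and converges
to a finite limit. -/
theorem stmt14 {N K : ℕ} (hN : 0 < N) (hK : 0 < K)
    (p : Fin K → ℕ) (hp : ∀ i, 1 ≤ p i ∧ p i ≤ N)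
    (A : ∀ i, Matrix (Fin (p i)) (Fin N) ℂ)
    (B : ∀ i, Matrix (Fin (N - p i)) (Fin N) ℂ)
    (hAB : ∀ i, IsComplementarySelectionPair (A i) (B i))
    (y : ∀ i, Fin (p i) → ℂ)
    (δ : ℝ) (hδ : 0 < δ)
    (C : Set (Matrix (Fin N) (Fin N) ℂ))
    (hCpos : ∀ M ∈ C, M.PosDef)
    (hCmin : ∀ M ∈ C, (M - (δ : ℂ) • (1 : Matrix (Fin N) (Fin N) ℂ)).PosSemidef)
    (Mseq : ℕ → Matrix (Fin N) (Fin N) ℂ)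
    (hmem : ∀ h, Mseq h ∈ C)
    (hmax : ∀ h, ∀ M ∈ C,
      -Real.log (M.det.re) - ((M⁻¹ * SigmaEM p A B y (Mseq h)).trace).re
        ≤ -Real.log ((Mseq (h + 1)).det.re)
          - (((Mseq (h + 1))⁻¹ * SigmaEM p A B y (Mseq h)).trace).re) :
    Monotone (fun h => obsLogLik p A y (Mseq h)) ∧
    ∃ l : ℝ, Filter.Tendsto (fun h => obsLogLik p A y (Mseq h)) Filter.atTop (nhds l) := by
  have hs := fun i => selPair (hAB i)
  have hmono : Monotone (fun h => obsLogLik p A y (Mseq h)) := by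
    refine monotone_nat_of_le_succ fun h => ?_
    have hP := hCpos _ (hmem h)
    have hP' := hCpos _ (hmem (h + 1))
    have h1 := Finset.sum_le_sum (s := Finset.univ) fun i _ => key (hs i) hP' hP (y i)
    rw [Finset.sum_sub_distrib, Finset.sum_sub_distrib, trace_Sigma hK, trace_Sigma hK] at h1
    have h2 := hmax h _ (hmem h)
    have h3 : (0 : ℝ) < K := by positivity
    have h4 : (K : ℝ) * (Real.log (Mseq (h + 1)).det.re
        + (((Mseq (h + 1))⁻¹ * SigmaEM p A B y (Mseq h)).trace).re)
        ≤ K * (Real.log (Mseq h).det.re + (((Mseq h)⁻¹ * SigmaEM p A B y (Mseq h)).trace).re) :=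
      mul_le_mul_of_nonneg_left (by linarith) h3.le
    simp only [obsLogLik, add_assoc]
    rw [Finset.sum_add_distrib (f := fun i => (p i : ℝ) * Real.log Real.pi),
      Finset.sum_add_distrib (f := fun i => (p i : ℝ) * Real.log Real.pi)]
    linarith
  refine ⟨hmono, _, tendsto_atTop_ciSup hmono ?_⟩
  refine ⟨-∑ i, ((p i : ℝ) * Real.log Real.pi + p i * Real.log δ), ?_⟩
  rintro _ ⟨h, rfl⟩
  simp only [obsLogLik]
  refine neg_le_neg (Finset.sum_le_sum fun i _ => ?_)
  have hP := (hs i).posDef (hCpos _ (hmem h))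
  have h1 := hP.inv.posSemidef.dotProduct_mulVec_nonneg (y i)
  have h2 := (Complex.le_def.mp h1).1
  have h3 : (A i * Mseq h * (A i)ᴴ - (δ : ℂ) • (1 : Matrix (Fin (p i)) (Fin (p i)) ℂ)).PosSemidef := by
    have := (hCmin _ (hmem h)).mul_mul_conjTranspose_same (A i)
    simpa [Matrix.mul_sub, Matrix.sub_mul, (hs i).aa] using this
  have h4 := aux_logdet_lb hP hδ h3
  simp only [Complex.zero_re] at h2
  linarith
end
end
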